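/- Let ω₁, ω₂, ω₃, ω₄ be ℝ-linearly independent quaternions with lattice Λ = {w_k : k ∈ ℤ⁴}, w_k = 2(k₁ω₁ + ⋯ + k₄ω₄), and let ζ₄ be the associated Weierstrass zeta function on ℍ \ Λ. Let ϖ ∈ ℍ satisfy 2ϖ ∈ Λ and ϖ ∉ Λ. Then for every x ∈ ℍ with x ∉ Λ, ζ₄(x + 2ϖ) − ζ₄(x) = 2ζ₄(ϖ) + (iteratedFDeriv ℝ 2 ζ₄ ϖ)(x + ϖ, x + ϖ), i.e. the difference equals 2ζ₄(ϖ) plus the second directional derivative of ζ₄ at ϖ in the direction x + ϖ; in particular it is a quaternion-valued polynomial of degree 2 in x. -/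

import Mathlib

noncomputable section

/-- The lattice vector `w_k = 2(k₁ω₁ + ⋯ + k₄ω₄)` in the quaternions. -/
def wk (ω : Fin 4 → Quaternion ℝ) (k : Fin 4 → ℤ) : Quaternion ℝ :=
  2 * ∑ i : Fin 4, (k i : ℝ) • ω i

/-- The Weierstrass zeta function
`ζ₄(x) = x⁻¹ + Σ_{k ≠ 0} [ (x − w_k)⁻¹ + Σ_{μ=0}^{3} (w_k⁻¹x)^μ w_k⁻¹ ]`. -/
def zeta4 (ω : Fin 4 → Quaternion ℝ) (x : Quaternion ℝ) : Quaternion ℝ :=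
  x⁻¹ + ∑' k : {k : Fin 4 → ℤ // k ≠ 0},
    ((x - wk ω k.1)⁻¹ +
      ∑ μ ∈ Finset.range 4, ((wk ω k.1)⁻¹ * x) ^ μ * (wk ω k.1)⁻¹)

open Topology Filter Set

section Calculus

variable {E F : Type*} [NormedAddCommGroup E] [NormedSpace ℝ E]
  [NormedAddCommGroup F] [NormedSpace ℝ F]

/-- `f` is `C²` on `s` and its derivatives of order at most two are bounded by `A` there. -/
def BoundedC2On (f : E → F) (s : Set E) (A : ℝ) : Prop :=
  ContDiffOn ℝ 2 f s ∧ ∀ x ∈ s, ∀ n ≤ 2, ‖iteratedFDerivWithin ℝ n f s x‖ ≤ A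

namespace BoundedC2On

lemma congr {f g : E → F} {s : Set E} {A : ℝ} (hf : BoundedC2On f s A) (h : EqOn g f s) :
    BoundedC2On g s A :=
  ⟨hf.1.congr h, fun x hx n hn => by
    rw [iteratedFDerivWithin_congr h hx]
    exact hf.2 x hx n hn⟩

lemma mono {f : E → F} {s : Set E} {A B : ℝ} (hf : BoundedC2On f s A) (h : A ≤ B) :
    BoundedC2On f s B :=
  ⟨hf.1, fun x hx n hn => (hf.2 x hx n hn).trans h⟩

lemma mul {R : Type*} [NormedRing R] [NormedAlgebra ℝ R] {f g : E → R} {s : Set E} {A B : ℝ}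
    (hs : IsOpen s) (hf : BoundedC2On f s A) (hg : BoundedC2On g s B) :
    BoundedC2On (fun x => f x * g x) s (4 * A * B) := by
  refine ⟨hf.1.mul hg.1, fun x hx n hn => ?_⟩
  have hA : 0 ≤ A := (norm_nonneg _).trans (hf.2 x hx 0 (by norm_num))
  have hB : 0 ≤ B := (norm_nonneg _).trans (hg.2 x hx 0 (by norm_num))
  have hn' : (n : WithTop ℕ∞) ≤ 2 := mod_cast hn
  calc _ ≤ _ := norm_iteratedFDerivWithin_mul_le hf.1 hg.1 hs.uniqueDiffOn hx hn'
    _ ≤ ∑ i ∈ Finset.range (n + 1), (n.choose i : ℝ) * A * B := by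
        refine Finset.sum_le_sum fun i hi => ?_
        have hi' : i ≤ n := Nat.lt_succ_iff.1 (Finset.mem_range.1 hi)
        gcongr
        · exact hf.2 x hx i (hi'.trans hn)
        · exact hg.2 x hx (n - i) ((Nat.sub_le _ _).trans hn)
    _ = 2 ^ n * A * B := by
        rw [← Finset.sum_mul, ← Finset.sum_mul]
        congr 2
        exact_mod_cast Nat.sum_range_choose n
    _ ≤ 4 * A * B := by
        gcongr
        calc (2 : ℝ) ^ n ≤ 2 ^ 2 := pow_le_pow_right₀ (by norm_num) hn
          _ = 4 := by norm_num

lemma of_fderiv {f : E → F} {s : Set E} {A : ℝ} (hs : IsOpen s) (hf : ContDiffOn ℝ 2 f s)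
    (h0 : ∀ x ∈ s, ‖f x‖ ≤ A) (h1 : ∀ x ∈ s, ‖fderivWithin ℝ f s x‖ ≤ A)
    (h2 : ∀ x ∈ s, ‖iteratedFDerivWithin ℝ 1 (fderivWithin ℝ f s) s x‖ ≤ A) :
    BoundedC2On f s A := by
  refine ⟨hf, fun x hx n hn => ?_⟩
  interval_cases n
  · simpa using h0 x hx
  · rw [← norm_iteratedFDerivWithin_fderivWithin hs.uniqueDiffOn hx]
    simpa using h1 x hx
  · rw [← norm_iteratedFDerivWithin_fderivWithin hs.uniqueDiffOn hx]
    exact h2 x hx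

lemma continuousLinearMap (L : E →L[ℝ] F) {s : Set E} {M R : ℝ} (hs : IsOpen s)
    (hL : ‖L‖ ≤ M) (hR : ∀ x ∈ s, ‖x‖ ≤ R) : BoundedC2On L s (M * (R + 1)) := by
  have hM : 0 ≤ M := (norm_nonneg _).trans hL
  have key : EqOn (fderivWithin ℝ L s) (fun _ => L) s := fun x hx =>
    L.fderivWithin (hs.uniqueDiffWithinAt hx)
  have hb : ∀ x ∈ s, M ≤ M * (R + 1) := fun x hx => by
    nlinarith [(norm_nonneg x).trans (hR x hx)]
  refine of_fderiv hs L.contDiff.contDiffOn (fun x hx => ?_) (fun x hx => ?_) (fun x hx => ?_)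
  · have := L.le_of_opNorm_le hL x
    nlinarith [hR x hx]
  · rw [key hx]
    exact hL.trans (hb x hx)
  · rw [iteratedFDerivWithin_congr key hx, iteratedFDerivWithin_const_of_ne (by norm_num)]
    simpa using hM.trans (hb x hx)

lemma inv_sub {D : Type*} [NormedDivisionRing D] [NormedAlgebra ℝ D] [CompleteSpace D]
    {s : Set D} {w : D} {M K : ℝ} (hs : IsOpen s) (hw : w ∉ s)
    (hM : ∀ x ∈ s, ‖(x - w)⁻¹‖ ≤ M) (hK : ∀ x ∈ s, ‖(x - w)⁻¹‖ ≤ K) :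
    BoundedC2On (fun x => (x - w)⁻¹) s (M * (1 + K + 2 * K ^ 2)) := by
  have hne : ∀ x ∈ s, x - w ≠ 0 := fun x hx h => hw (sub_eq_zero.1 h ▸ hx)
  have hinv : ∀ z : D, z ≠ 0 → ContDiffAt ℝ 2 Inv.inv z := fun z hz => by
    simpa only [Ring.inverse_eq_inv'] using! contDiffAt_ringInverse ℝ (Units.mk0 z hz)
  have hcd : ContDiffOn ℝ 2 (fun x : D => (x - w)⁻¹) s := fun x hx =>
    (ContDiffAt.comp x (hinv _ (hne x hx))
      (contDiffAt_id.sub contDiffAt_const)).contDiffWithinAt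
  have key : EqOn (fderivWithin ℝ (fun x : D => (x - w)⁻¹) s)
      (-fun x => ContinuousLinearMap.mulLeftRight ℝ D (x - w)⁻¹ (x - w)⁻¹) s := fun x hx => by
    have h1 : HasFDerivAt (fun x : D => (x - w)⁻¹) _ x :=
      (hasFDerivAt_inv' (𝕜 := ℝ) (hne x hx)).comp x ((hasFDerivAt_id x).sub_const w)
    rw [fderivWithin_of_isOpen hs hx, h1.fderiv]
    rfl
  have hsq : ∀ x ∈ s, ‖fderivWithin ℝ (fun x : D => (x - w)⁻¹) s x‖ ≤ M * K := fun x hx => by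
    rw [key hx]
    have h := ContinuousLinearMap.opNorm_mulLeftRight_apply_apply_le ℝ D (x - w)⁻¹ (x - w)⁻¹
    rw [Pi.neg_apply, norm_neg]
    exact h.trans (mul_le_mul (hM x hx) (hK x hx) (norm_nonneg _)
      ((norm_nonneg _).trans (hM x hx)))
  refine of_fderiv hs hcd (fun x hx => ?_) (fun x hx => ?_) (fun x hx => ?_) <;>
    have hM0 := (norm_nonneg _).trans (hM x hx) <;>
    have hK0 := (norm_nonneg _).trans (hK x hx) <;>
    have hMK := mul_nonneg hM0 hK0 <;>
    have hMKK := mul_nonneg hMK hK0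
  · nlinarith [hM x hx]
  · nlinarith [hsq x hx]
  · rw [iteratedFDerivWithin_congr key hx, iteratedFDerivWithin_neg_apply hs.uniqueDiffOn hx,
      norm_neg]
    have h := ContinuousLinearMap.norm_iteratedFDerivWithin_le_of_bilinear_of_le_one
      (ContinuousLinearMap.mulLeftRight ℝ D) hcd hcd hs.uniqueDiffOn hx (n := 1)
      (by norm_num) (ContinuousLinearMap.opNorm_mulLeftRight_le ℝ D)
    have h1 : ‖iteratedFDerivWithin ℝ 1 (fun x : D => (x - w)⁻¹) s x‖ ≤ M * K := by
      rw [← norm_iteratedFDerivWithin_fderivWithin hs.uniqueDiffOn hx]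
      simpa using hsq x hx
    simp only [Finset.sum_range_succ, Finset.sum_range_zero, norm_iteratedFDerivWithin_zero,
      Nat.choose_zero_right, Nat.choose_self, Nat.cast_one, one_mul, zero_add, Nat.sub_zero] at h
    rw [norm_iteratedFDerivWithin_zero] at h
    have h2 := hK x hx
    have h3 := norm_nonneg ((x - w)⁻¹)
    have h4 := mul_le_mul h2 h1 (norm_nonneg _) hK0
    have h5 := mul_le_mul h1 h2 h3 hMK
    nlinarith

end BoundedC2On

/-- If the even part of `f` about `a` is exactly quadratic along `y`, then its coefficient is the
second derivative. -/
lemma iteratedFDeriv_two_eq_of_even_part {f : E → F} {a y : E} {c : F}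
    (h1 : ∀ᶠ z in 𝓝 a, DifferentiableAt ℝ f z) (h2 : DifferentiableAt ℝ (fderiv ℝ f) a)
    (h : ∀ᶠ t : ℝ in 𝓝 0, f (a + t • y) + f (a - t • y) - (f a + f a) = t ^ 2 • c) :
    iteratedFDeriv ℝ 2 f a (fun _ => y) = c := by
  rw [iteratedFDeriv_two_apply]
  have line : ∀ (v : E) (t : ℝ), HasDerivAt (fun t : ℝ => a + t • v) v t := fun v t => by
    simpa using ((hasDerivAt_id t).smul_const v).const_add a
  have tend : ∀ v : E, Tendsto (fun t : ℝ => a + t • v) (𝓝 0) (𝓝 a) := fun v => by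
    simpa using (line v 0).continuousAt.tendsto
  have first : ∀ᶠ t : ℝ in 𝓝 0,
      fderiv ℝ f (a + t • y) y - fderiv ℝ f (a + t • -y) y = (2 * t) • c := by
    filter_upwards [h.eventually_nhds, (tend y).eventually h1, (tend (-y)).eventually h1]
      with t ht hp hm
    have d1 := ((hp.hasFDerivAt.comp_hasDerivAt t (line y t)).add
      (hm.hasFDerivAt.comp_hasDerivAt t (line (-y) t))).sub_const (f a + f a)
    have d2 : HasDerivAt (fun t : ℝ => t ^ 2 • c) ((2 * t) • c) t := by
      simpa using (hasDerivAt_pow 2 t).smul_const c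
    have d3 := d2.congr_of_eventuallyEq (f₁ := fun t : ℝ =>
      f (a + t • y) + f (a + t • -y) - (f a + f a)) (by
        filter_upwards [ht] with r hr
        rw [← hr, smul_neg, ← sub_eq_add_neg])
    have := d1.unique d3
    simpa [sub_eq_add_neg] using this
  have second : ∀ v : E, HasDerivAt (fun t : ℝ => fderiv ℝ f (a + t • v) y)
      (fderiv ℝ (fderiv ℝ f) a v y) 0 := fun v => by
    have h2' : HasFDerivAt (fderiv ℝ f) (fderiv ℝ (fderiv ℝ f) a) (a + (0 : ℝ) • v) := by
      simpa using h2.hasFDerivAt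
    have h3 := h2'.comp_hasDerivAt (0 : ℝ) (line v 0)
    have h4 := h3.clm_apply (hasDerivAt_const (0 : ℝ) y)
    rw [map_zero, add_zero] at h4
    exact h4
  have d1 := (second y).sub (second (-y))
  have d2 : HasDerivAt (fun t : ℝ => (2 * t) • c) ((2 : ℝ) • c) 0 := by
    simpa using ((hasDerivAt_id (0 : ℝ)).const_mul 2).smul_const c
  have := d1.unique (d2.congr_of_eventuallyEq first)
  rw [map_neg, _root_.neg_apply, sub_neg_eq_add, ← two_smul ℝ] at this
  exact smul_right_injective F (two_ne_zero (α := ℝ)) this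

variable {α : Type*} [CompleteSpace F] {f : α → E → F} {u : α → ℝ} {s : Set E}

lemma summable_of_boundedC2On (hu : Summable u) (hf : ∀ n, BoundedC2On (f n) s (u n))
    {x : E} (hx : x ∈ s) : Summable fun n => f n x :=
  Summable.of_norm_bounded hu fun n => by simpa using (hf n).2 x hx 0 (by norm_num)

lemma hasFDerivAt_tsum_of_boundedC2On (hu : Summable u) (hs : IsOpen s) (hs' : IsPreconnected s)
    (hf : ∀ n, BoundedC2On (f n) s (u n)) {x : E} (hx : x ∈ s) :
    HasFDerivAt (fun y => ∑' n, f n y) (∑' n, fderiv ℝ (f n) x) x := by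
  refine hasFDerivAt_tsum_of_isPreconnected hu hs hs' (fun n y hy => ?_) (fun n y hy => ?_) hx
    (summable_of_boundedC2On hu hf hx) hx
  · exact (((hf n).1.contDiffAt (hs.mem_nhds hy)).differentiableAt (by norm_num)).hasFDerivAt
  · rw [← norm_iteratedFDeriv_one, ← iteratedFDerivWithin_of_isOpen 1 hs hy]
    exact (hf n).2 y hy 1 (by norm_num)

lemma differentiableAt_fderiv_tsum_of_boundedC2On (hu : Summable u) (hs : IsOpen s)
    (hs' : IsPreconnected s) (hf : ∀ n, BoundedC2On (f n) s (u n)) {x : E} (hx : x ∈ s) :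
    DifferentiableAt ℝ (fderiv ℝ fun y => ∑' n, f n y) x := by
  have h : HasFDerivAt (fun y => ∑' n, fderiv ℝ (f n) y)
      (∑' n, fderiv ℝ (fderiv ℝ (f n)) x) x := by
    refine hasFDerivAt_tsum_of_isPreconnected hu hs hs' (fun n y hy => ?_) (fun n y hy => ?_) hx
      (Summable.of_norm_bounded hu fun n => ?_) hx
    · exact ((((hf n).1.contDiffAt (hs.mem_nhds hy)).fderiv_right (m := 1)
        (by norm_num)).differentiableAt (by norm_num)).hasFDerivAt
    · rw [← norm_iteratedFDeriv_one, norm_iteratedFDeriv_fderiv,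
        ← iteratedFDerivWithin_of_isOpen _ hs hy]
      exact (hf n).2 y hy 2 le_rfl
    · rw [← norm_iteratedFDeriv_one, ← iteratedFDerivWithin_of_isOpen 1 hs hx]
      exact (hf n).2 x hx 1 (by norm_num)
  refine h.differentiableAt.congr_of_eventuallyEq ?_
  filter_upwards [hs.mem_nhds hx] with y hy
  exact (hasFDerivAt_tsum_of_boundedC2On hu hs hs' hf hy).fderiv

end Calculus

/-- The contribution of the lattice vector `w` to the zeta function; for `w = 0` it is `x⁻¹`. -/
def zetaTerm (w x : Quaternion ℝ) : Quaternion ℝ :=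
  (x - w)⁻¹ + ∑ μ ∈ Finset.range 4, (w⁻¹ * x) ^ μ * w⁻¹

lemma zetaTerm_zero (x : Quaternion ℝ) : zetaTerm 0 x = x⁻¹ := by
  simp [zetaTerm]

lemma zetaTerm_neg_neg (w x : Quaternion ℝ) : zetaTerm (-w) (-x) = -zetaTerm w x := by
  have h : -x - -w = -(x - w) := by abel
  have h' : (-w)⁻¹ * -x = w⁻¹ * x := by rw [inv_neg, neg_mul_neg]
  simp only [zetaTerm, h, h']
  simp only [inv_neg, mul_neg, Finset.sum_neg_distrib, neg_add]

/-- The Taylor remainder of `(x - w)⁻¹` in closed form. -/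
lemma zetaTerm_eq {w x : Quaternion ℝ} (hw : w ≠ 0) (hx : x ≠ w) :
    zetaTerm w x = (w⁻¹ * x) * ((w⁻¹ * x) * ((w⁻¹ * x) * ((w⁻¹ * x) * (x - w)⁻¹))) := by
  have h : x - w ≠ 0 := sub_ne_zero.2 hx
  have hinv : w⁻¹ = (w⁻¹ * x - 1) * (x - w)⁻¹ := by
    rw [eq_mul_inv_iff_mul_eq₀ h, mul_sub, inv_mul_cancel₀ hw]
  apply mul_right_cancel₀ h
  have hgeom : ∀ u : Quaternion ℝ, ∀ v : Quaternion ℝ, v * (x - w) = u - 1 →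
      (∑ μ ∈ Finset.range 4, u ^ μ * v) * (x - w) = u ^ 4 - 1 := fun u v huv => by
    simp only [Finset.sum_mul, mul_assoc, huv]
    simp only [Finset.sum_range_succ, Finset.sum_range_zero]
    noncomm_ring
  rw [zetaTerm, add_mul, hgeom _ _ (by rw [mul_sub, inv_mul_cancel₀ hw]), inv_mul_cancel₀ h]
  simp only [mul_assoc, inv_mul_cancel₀ h, mul_one]
  simp only [pow_succ, pow_zero, one_mul, mul_assoc]
  abel

/-- The second symmetric difference of `zetaTerm w` about `a`. -/
def zetaTermDiff (a y w : Quaternion ℝ) : Quaternion ℝ :=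
  zetaTerm w (a + y) + zetaTerm w (a - y) - (zetaTerm w a + zetaTerm w a)

lemma zetaTermDiff_smul_sub (a y w : Quaternion ℝ) (t : ℝ) :
    zetaTermDiff a (t • y) w - t ^ 2 • zetaTermDiff a y w =
      ((a + t • y - w)⁻¹ + (a - t • y - w)⁻¹ - ((a - w)⁻¹ + (a - w)⁻¹)) -
        t ^ 2 • ((a + y - w)⁻¹ + (a - y - w)⁻¹ - ((a - w)⁻¹ + (a - w)⁻¹)) := by
  have poly : ∀ A B v : Quaternion ℝ,
      ∑ μ ∈ Finset.range 4, (A + B) ^ μ * v + ∑ μ ∈ Finset.range 4, (A - B) ^ μ * v -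
        (∑ μ ∈ Finset.range 4, A ^ μ * v + ∑ μ ∈ Finset.range 4, A ^ μ * v) =
      (2 : ℝ) • ((B * B + A * B * B + B * A * B + B * B * A) * v) := fun A B v => by
    simp only [Finset.sum_range_succ, Finset.sum_range_zero, two_smul]
    noncomm_ring
  have h1 := poly (w⁻¹ * a) (w⁻¹ * y) w⁻¹
  have h2 := poly (w⁻¹ * a) (w⁻¹ * (t • y)) w⁻¹
  have h3 : (2 : ℝ) • ((w⁻¹ * (t • y) * (w⁻¹ * (t • y)) + w⁻¹ * a * (w⁻¹ * (t • y)) *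
      (w⁻¹ * (t • y)) + w⁻¹ * (t • y) * (w⁻¹ * a) * (w⁻¹ * (t • y)) +
      w⁻¹ * (t • y) * (w⁻¹ * (t • y)) * (w⁻¹ * a)) * w⁻¹) =
      t ^ 2 • (2 : ℝ) • ((w⁻¹ * y * (w⁻¹ * y) + w⁻¹ * a * (w⁻¹ * y) * (w⁻¹ * y) +
      w⁻¹ * y * (w⁻¹ * a) * (w⁻¹ * y) + w⁻¹ * y * (w⁻¹ * y) * (w⁻¹ * a)) * w⁻¹) := by
    simp only [mul_smul_comm, smul_mul_assoc, add_mul]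
    module
  rw [h3, ← h1] at h2
  simp only [zetaTermDiff, zetaTerm, mul_add, mul_sub]
  rw [← sub_eq_zero] at h2 ⊢
  rw [← h2]
  module

lemma zetaTermDiff_reflect (a y w : Quaternion ℝ) (t : ℝ) :
    zetaTermDiff a (t • y) (2 * a - w) - t ^ 2 • zetaTermDiff a y (2 * a - w) =
      -(zetaTermDiff a (t • y) w - t ^ 2 • zetaTermDiff a y w) := by
  have h : ∀ z, a + z - (2 * a - w) = -(a - z - w) := fun z => by rw [two_mul]; abel
  have h' : ∀ z, a - z - (2 * a - w) = -(a + z - w) := fun z => by rw [two_mul]; abel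
  have h'' : a - (2 * a - w) = -(a - w) := by rw [two_mul]; abel
  simp only [zetaTermDiff_smul_sub, h, h', h'', inv_neg]
  module

section Lattice

variable {ω : Fin 4 → Quaternion ℝ}

lemma wk_zero (ω : Fin 4 → Quaternion ℝ) : wk ω 0 = 0 := by simp [wk]

lemma wk_sub (ω : Fin 4 → Quaternion ℝ) (k l : Fin 4 → ℤ) : wk ω (k - l) = wk ω k - wk ω l := by
  simp [wk, sub_smul, mul_sub]

lemma wk_neg (ω : Fin 4 → Quaternion ℝ) (k : Fin 4 → ℤ) : wk ω (-k) = -wk ω k := by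
  simp [wk]

/-- The period basis `2ω₁, …, 2ω₄`. -/
def periodBasis (hω : LinearIndependent ℝ ω) : Module.Basis (Fin 4) ℝ (Quaternion ℝ) :=
  (basisOfLinearIndependentOfCardEqFinrank hω (by simp [Quaternion.finrank_eq_four])).isUnitSMul
    (w := fun _ => (2 : ℝ)) (fun _ => isUnit_iff_ne_zero.2 two_ne_zero)

lemma periodBasis_apply (hω : LinearIndependent ℝ ω) (i : Fin 4) :
    periodBasis hω i = (2 : ℝ) • ω i := by
  simp [periodBasis, Module.Basis.isUnitSMul_apply]

/-- Lattice points are parametrised by their integer coordinates. -/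
def latticeEquiv (hω : LinearIndependent ℝ ω) :
    (Fin 4 → ℤ) ≃ Submodule.span ℤ (range (periodBasis hω)) :=
  ((periodBasis hω).restrictScalars ℤ).equivFun.symm.toEquiv

lemma latticeEquiv_apply (hω : LinearIndependent ℝ ω) (k : Fin 4 → ℤ) :
    (latticeEquiv hω k : Quaternion ℝ) = wk ω k := by
  simp [latticeEquiv, Module.Basis.equivFun_symm_apply, periodBasis_apply, wk, Finset.mul_sum,
    ← Int.cast_smul_eq_zsmul ℝ, two_smul, two_mul, smul_add]

lemma wk_injective (hω : LinearIndependent ℝ ω) : Function.Injective (wk ω) := fun k l h =>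
  (latticeEquiv hω).injective (Subtype.ext (by simpa [latticeEquiv_apply] using h))

lemma summable_wk_pow (hω : LinearIndependent ℝ ω) : Summable fun k => ‖wk ω k‖⁻¹ ^ 5 := by
  have hr : Module.finrank ℤ (Submodule.span ℤ (range (periodBasis hω))) < 5 := by
    rw [Module.finrank_eq_card_basis ((periodBasis hω).restrictScalars ℤ)]
    simp
  have h := (latticeEquiv hω).summable_iff.2 (ZLattice.summable_norm_pow_inv _ 5 hr)
  refine h.congr fun k => ?_
  simp [← latticeEquiv_apply hω]

lemma isClosed_range_wk (hω : LinearIndependent ℝ ω) : IsClosed (range (wk ω)) := by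
  have h : range (wk ω) = (Submodule.span ℤ (range (periodBasis hω))).toAddSubgroup := by
    ext x
    constructor
    · rintro ⟨k, rfl⟩
      rw [← latticeEquiv_apply hω]
      exact (latticeEquiv hω k).2
    · intro hx
      refine ⟨(latticeEquiv hω).symm ⟨x, hx⟩, ?_⟩
      rw [← latticeEquiv_apply hω, Equiv.apply_symm_apply]
  rw [h]
  have : DiscreteTopology (Submodule.span ℤ (range (periodBasis hω))).toAddSubgroup :=
    inferInstanceAs (DiscreteTopology (Submodule.span ℤ (range (periodBasis hω))))
  exact AddSubgroup.isClosed_of_discrete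

lemma exists_boundedC2On_zetaTerm (hω : LinearIndependent ℝ ω) {a : Quaternion ℝ}
    (ha : a ∉ range (wk ω)) :
    ∃ r > 0, ∃ u : (Fin 4 → ℤ) → ℝ, Summable u ∧
      ∀ k, BoundedC2On (zetaTerm (wk ω k)) (Metric.ball a r) (u k) := by
  obtain ⟨r, hr, hball⟩ : ∃ r > 0, Metric.ball a (r + r) ⊆ (range (wk ω))ᶜ := by
    obtain ⟨e, he, h⟩ := Metric.isOpen_iff.1 (isClosed_range_wk hω).isOpen_compl a ha
    exact ⟨e / 2, half_pos he, by simpa using h⟩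
  have hdist : ∀ k, ∀ x ∈ Metric.ball a r, r ≤ ‖x - wk ω k‖ := fun k x hx => by
    by_contra! hlt
    refine hball (a := wk ω k) ?_ ⟨k, rfl⟩
    rw [Metric.mem_ball, dist_comm] at hx ⊢
    calc dist a (wk ω k) ≤ dist a x + dist x (wk ω k) := dist_triangle _ _ _
      _ < r + r := add_lt_add hx (by rwa [dist_eq_norm])
  have hinv : ∀ k, ∀ x ∈ Metric.ball a r, ‖(x - wk ω k)⁻¹‖ ≤ r⁻¹ := fun k x hx => by
    rw [norm_inv]
    exact inv_anti₀ hr (hdist k x hx)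
  have hnotMem : ∀ k, wk ω k ∉ Metric.ball a r := fun k hk => by
    have := hdist k _ hk
    simp only [sub_self, norm_zero] at this
    linarith
  set R := ‖a‖ + r with hRdef
  have hR : ∀ x ∈ Metric.ball a r, ‖x‖ ≤ R := fun x hx => by
    have h1 := norm_le_norm_add_norm_sub' x a
    rw [Metric.mem_ball, dist_eq_norm] at hx
    linarith
  have hR0 : 0 ≤ R := by positivity
  set K := 1 + r⁻¹ + 2 * r⁻¹ ^ 2
  set C := 4 * (R + 1) * (4 * (R + 1) * (4 * (R + 1) * (4 * (R + 1) * ((1 + R / r) * K))))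
  refine ⟨r, hr, fun k => ‖wk ω k‖⁻¹ ^ 5 * C + if k = 0 then r⁻¹ * K else 0,
    ((summable_wk_pow hω).mul_right C).add (hasSum_ite_eq 0 _).summable, fun k => ?_⟩
  by_cases hk : k = 0
  · subst hk
    simp only [wk_zero, norm_zero, inv_zero, if_true]
    have h := BoundedC2On.inv_sub Metric.isOpen_ball (hnotMem 0) (hinv 0) (hinv 0)
    refine (h.congr fun x _ => ?_).mono (by simp [K])
    rw [wk_zero, zetaTerm_zero, sub_zero]
  · have hw : wk ω k ≠ 0 := fun h => hk (wk_injective hω (h.trans (wk_zero ω).symm))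
    have hwpos : 0 < ‖wk ω k‖ := norm_pos_iff.2 hw
    have hdecay : ∀ x ∈ Metric.ball a r, ‖(x - wk ω k)⁻¹‖ ≤ ‖wk ω k‖⁻¹ * (1 + R / r) :=
      fun x hx => by
        have h1 := hdist k x hx
        have hpos : 0 < ‖x - wk ω k‖ := hr.trans_le h1
        have h2 : ‖wk ω k‖ ≤ ‖x - wk ω k‖ * (1 + R / r) := by
          have h3 := norm_le_norm_add_norm_sub x (wk ω k)
          have h4 : R ≤ ‖x - wk ω k‖ * (R / r) := by
            calc R = r * (R / r) := by field_simp
              _ ≤ _ := by gcongr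
          linarith [hR x hx]
        rw [norm_inv, inv_mul_eq_div, inv_eq_one_div, div_le_div_iff₀ hpos hwpos]
        linarith
    have hi := BoundedC2On.inv_sub Metric.isOpen_ball (hnotMem k) hdecay (hinv k)
    have hl := BoundedC2On.continuousLinearMap (s := Metric.ball a r) (M := ‖wk ω k‖⁻¹)
      (ContinuousLinearMap.mul ℝ (Quaternion ℝ) (wk ω k)⁻¹) Metric.isOpen_ball
      ((ContinuousLinearMap.opNorm_mul_apply_le ℝ (Quaternion ℝ) _).trans (norm_inv _).le) hR
    have h := hl.mul Metric.isOpen_ball (hl.mul Metric.isOpen_ball (hl.mul Metric.isOpen_ball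
      (hl.mul Metric.isOpen_ball hi)))
    refine (h.congr fun x hx => ?_).mono (le_of_eq ?_)
    · exact zetaTerm_eq hw (ne_of_mem_of_not_mem hx (hnotMem k))
    · simp only [hk, if_false, C, K]
      ring

lemma summable_zetaTerm (hω : LinearIndependent ℝ ω) {x : Quaternion ℝ}
    (hx : x ∉ range (wk ω)) : Summable fun k => zetaTerm (wk ω k) x := by
  obtain ⟨r, hr, u, hu, hb⟩ := exists_boundedC2On_zetaTerm hω hx
  exact summable_of_boundedC2On hu hb (Metric.mem_ball_self hr)

lemma zeta4_eq_tsum (hω : LinearIndependent ℝ ω) {x : Quaternion ℝ}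
    (hx : x ∉ range (wk ω)) : zeta4 ω x = ∑' k, zetaTerm (wk ω k) x := by
  have h := (summable_zetaTerm hω hx).tsum_subtype_add_tsum_subtype_compl {0}
  rw [tsum_singleton 0 fun k => zetaTerm (wk ω k) x, wk_zero, zetaTerm_zero] at h
  exact h

lemma zeta4_neg (hω : LinearIndependent ℝ ω) {x : Quaternion ℝ} (hx : x ∉ range (wk ω))
    (hx' : -x ∉ range (wk ω)) : zeta4 ω (-x) = -zeta4 ω x := by
  rw [zeta4_eq_tsum hω hx, zeta4_eq_tsum hω hx', ← tsum_neg, ← (Equiv.neg _).tsum_eq]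
  simp [wk_neg, zetaTerm_neg_neg]

lemma zeta4_regular (hω : LinearIndependent ℝ ω) {a : Quaternion ℝ} (ha : a ∉ range (wk ω)) :
    (∀ᶠ z in 𝓝 a, DifferentiableAt ℝ (zeta4 ω) z) ∧
      DifferentiableAt ℝ (fderiv ℝ (zeta4 ω)) a := by
  obtain ⟨r, hr, u, hu, hb⟩ := exists_boundedC2On_zetaTerm hω ha
  have hconn := (convex_ball a r).isPreconnected
  have heq : ∀ᶠ z in 𝓝 a, zeta4 ω z = ∑' k, zetaTerm (wk ω k) z := by
    filter_upwards [(isClosed_range_wk hω).isOpen_compl.mem_nhds ha] with z hz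
    exact zeta4_eq_tsum hω hz
  constructor
  · filter_upwards [heq.eventually_nhds, Metric.ball_mem_nhds a hr] with z hz hzr
    exact (hasFDerivAt_tsum_of_boundedC2On hu Metric.isOpen_ball hconn hb
      hzr).differentiableAt.congr_of_eventuallyEq hz
  · exact (differentiableAt_fderiv_tsum_of_boundedC2On hu Metric.isOpen_ball hconn hb
      (Metric.mem_ball_self hr)).congr_of_eventuallyEq (EventuallyEq.fderiv heq)

lemma hasSum_zetaTermDiff (hω : LinearIndependent ℝ ω) {a y : Quaternion ℝ}
    (ha : a ∉ range (wk ω)) (hp : a + y ∉ range (wk ω)) (hm : a - y ∉ range (wk ω)) :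
    HasSum (fun k => zetaTermDiff a y (wk ω k))
      (zeta4 ω (a + y) + zeta4 ω (a - y) - (zeta4 ω a + zeta4 ω a)) := by
  rw [zeta4_eq_tsum hω ha, zeta4_eq_tsum hω hp, zeta4_eq_tsum hω hm]
  have h := (summable_zetaTerm hω ha).hasSum
  exact ((summable_zetaTerm hω hp).hasSum.add (summable_zetaTerm hω hm).hasSum).sub (h.add h)

/-- About a half-period, the even part of `zeta4` is exactly quadratic. -/
lemma zeta4_even_part_smul (hω : LinearIndependent ℝ ω) {a y : Quaternion ℝ} {t : ℝ}
    (h2a : 2 * a ∈ range (wk ω)) (ha : a ∉ range (wk ω))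
    (hp : a + y ∉ range (wk ω)) (hm : a - y ∉ range (wk ω))
    (htp : a + t • y ∉ range (wk ω)) (htm : a - t • y ∉ range (wk ω)) :
    zeta4 ω (a + t • y) + zeta4 ω (a - t • y) - (zeta4 ω a + zeta4 ω a) =
      t ^ 2 • (zeta4 ω (a + y) + zeta4 ω (a - y) - (zeta4 ω a + zeta4 ω a)) := by
  obtain ⟨l, hl⟩ := h2a
  have h := (hasSum_zetaTermDiff hω ha htp htm).sub
    ((hasSum_zetaTermDiff hω ha hp hm).const_smul (t ^ 2))
  have h' := (Equiv.subLeft l).hasSum_iff.2 h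
  simp only [Function.comp_def, Equiv.subLeft_apply, wk_sub, hl, zetaTermDiff_reflect] at h'
  have : IsAddTorsionFree (Quaternion ℝ) := .of_module_rat _
  exact sub_eq_zero.1 (self_eq_neg.1 (h.unique (by simpa using h'.neg)))

end Lattice

/-- The paper's quasi-periodicity formula (5) for `ζ₄`: for a half-period `ϖ` and
`x` off the lattice, `ζ₄(x + 2ϖ) − ζ₄(x) = 2ζ₄(ϖ) + ((x+ϖ)|∇)² ζ₄ (ϖ)`. -/
theorem zeta4_quasiperiodic (ω : Fin 4 → Quaternion ℝ)
    (hω : LinearIndependent ℝ ω) (ϖ : Quaternion ℝ)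
    (hϖ1 : 2 * ϖ ∈ Set.range (wk ω)) (hϖ2 : ϖ ∉ Set.range (wk ω))
    (x : Quaternion ℝ) (hx : x ∉ Set.range (wk ω)) :
    zeta4 ω (x + 2 * ϖ) - zeta4 ω x =
      2 * zeta4 ω ϖ + (iteratedFDeriv ℝ 2 (zeta4 ω) ϖ) (fun _ => x + ϖ) := by
  have hplus : ϖ + (x + ϖ) = x + 2 * ϖ := by rw [two_mul]; abel
  have hminus : ϖ - (x + ϖ) = -x := by abel
  have hneg : -x ∉ range (wk ω) := by
    rintro ⟨k, hk⟩
    exact hx ⟨-k, by rw [wk_neg, hk, neg_neg]⟩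
  have hp : ϖ + (x + ϖ) ∉ range (wk ω) := by
    obtain ⟨l, hl⟩ := hϖ1
    rw [hplus, ← hl]
    rintro ⟨k, hk⟩
    exact hx ⟨k - l, by rw [wk_sub, hk, add_sub_cancel_right]⟩
  have hm : ϖ - (x + ϖ) ∉ range (wk ω) := hminus ▸ hneg
  have hopen := (isClosed_range_wk hω).isOpen_compl.mem_nhds hϖ2
  have hcp : Tendsto (fun t : ℝ => ϖ + t • (x + ϖ)) (𝓝 0) (𝓝 ϖ) := by
    have : Continuous fun t : ℝ => ϖ + t • (x + ϖ) := by fun_prop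
    simpa using this.tendsto 0
  have hcm : Tendsto (fun t : ℝ => ϖ - t • (x + ϖ)) (𝓝 0) (𝓝 ϖ) := by
    have : Continuous fun t : ℝ => ϖ - t • (x + ϖ) := by fun_prop
    simpa using this.tendsto 0
  obtain ⟨h1, h2⟩ := zeta4_regular hω hϖ2
  rw [iteratedFDeriv_two_eq_of_even_part h1 h2 (by
    filter_upwards [hcp.eventually hopen, hcm.eventually hopen] with t htp htm
    exact zeta4_even_part_smul hω hϖ1 hϖ2 hp hm htp htm)]
  rw [hplus, hminus, zeta4_neg hω hx hneg, two_mul (zeta4 ω ϖ)]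
  abel

end
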